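/- For every X = (S,Q,r) ∈ G, every ξ = (R,x) with R ∈ SO(3) and x ≠ 0, and all unit vectors p̊, p ∈ ℝ³, the measured output at the transformed state equals the output at the original state with transformed bearings: h(φ(X,ξ); (p̊,p)) = h(ξ; θ(X⁻¹,(p̊,p))), where X⁻¹ = (Sᵀ, Qᵀ, r⁻¹). -/

import Mathlib

open Matrix

/-- `SO(3)`: real 3×3 matrices with `RᵀR = I` and `det R = 1`. -/
def SO3 (R : Matrix (Fin 3) (Fin 3) ℝ) : Prop := Rᵀ * R = 1 ∧ R.det = 1

/-- The skew-symmetric matrix `a^×` with `a^× b = a × b`. -/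
def skew (a : Fin 3 → ℝ) : Matrix (Fin 3) (Fin 3) ℝ :=
  !![0, -a 2, a 1; a 2, 0, -a 0; -a 1, a 0, 0]

/-- The Euclidean norm of a vector in `ℝ³`. -/
noncomputable def enorm3 (x : Fin 3 → ℝ) : ℝ := Real.sqrt (x ⬝ᵥ x)

/-- The epipolar measurement `h((R,x);(p̊,p)) = p̊ᵀ (x/|x|)^× R p`. -/
noncomputable def hMeas (R : Matrix (Fin 3) (Fin 3) ℝ) (x pr p : Fin 3 → ℝ) : ℝ :=
  pr ⬝ᵥ (skew ((enorm3 x)⁻¹ • x) *ᵥ (R *ᵥ p))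

/-- The action `θ((S,Q,r),(p̊,p)) = (Qᵀp̊, Sᵀp)`. -/
noncomputable def theta (S Q : Matrix (Fin 3) (Fin 3) ℝ) (r : ℝ)
    (pr p : Fin 3 → ℝ) : (Fin 3 → ℝ) × (Fin 3 → ℝ) :=
  (Qᵀ *ᵥ pr, Sᵀ *ᵥ p)

theorem skew_smul (c : ℝ) (a : Fin 3 → ℝ) : skew (c • a) = c • skew a := by
  ext i j
  fin_cases i <;> fin_cases j <;> simp [skew]

/-- A linear map scales the scalar triple product by its determinant. -/
theorem mulVec_dotProduct_skew_mulVec (A : Matrix (Fin 3) (Fin 3) ℝ) (a b c : Fin 3 → ℝ) :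
    (A *ᵥ a) ⬝ᵥ (skew (A *ᵥ b) *ᵥ (A *ᵥ c)) = A.det * (a ⬝ᵥ (skew b *ᵥ c)) := by
  simp [skew, Matrix.det_fin_three, Matrix.mulVec, dotProduct, Fin.sum_univ_three]
  ring

theorem enorm3_smul {c : ℝ} (hc : 0 ≤ c) (x : Fin 3 → ℝ) :
    enorm3 (c • x) = c * enorm3 x := by
  simp only [enorm3, smul_dotProduct, dotProduct_smul, smul_eq_mul]
  rw [← mul_assoc, Real.sqrt_mul (mul_self_nonneg c), Real.sqrt_mul_self hc]

theorem enorm3_mulVec {A : Matrix (Fin 3) (Fin 3) ℝ} (hA : Aᵀ * A = 1) (x : Fin 3 → ℝ) :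
    enorm3 (A *ᵥ x) = enorm3 x := by
  rw [enorm3, dotProduct_mulVec, ← mulVec_transpose, mulVec_mulVec, hA, one_mulVec, enorm3]

theorem SO3.transpose {Q : Matrix (Fin 3) (Fin 3) ℝ} (hQ : SO3 Q) : SO3 Qᵀ :=
  ⟨by rw [transpose_transpose]; exact mul_eq_one_comm.mp hQ.1, by rw [det_transpose, hQ.2]⟩

theorem stmt7_output_at_transformed_state
    (S Q R : Matrix (Fin 3) (Fin 3) ℝ) (r : ℝ) (x pr p : Fin 3 → ℝ)
    (hS : SO3 S) (hQ : SO3 Q) (hr : 0 < r) (hR : SO3 R) (hx : x ≠ 0)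
    (hpr : enorm3 pr = 1) (hp : enorm3 p = 1) :
    hMeas (Qᵀ * R * S) (r⁻¹ • (Qᵀ *ᵥ x)) pr p
      = hMeas R x (theta Sᵀ Qᵀ r⁻¹ pr p).1 (theta Sᵀ Qᵀ r⁻¹ pr p).2 := by
  have scale : (enorm3 (r⁻¹ • (Qᵀ *ᵥ x)))⁻¹ • r⁻¹ • (Qᵀ *ᵥ x)
      = (enorm3 x)⁻¹ • (Qᵀ *ᵥ x) := by
    rw [enorm3_smul (inv_nonneg.mpr hr.le), enorm3_mulVec hQ.transpose.1, smul_smul]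
    congr 1
    field_simp
  have triple := mulVec_dotProduct_skew_mulVec Qᵀ (Q *ᵥ pr) x (R *ᵥ (S *ᵥ p))
  rw [hQ.transpose.2, one_mul, mulVec_mulVec _ Qᵀ Q, hQ.1, one_mulVec] at triple
  simp only [hMeas, theta, scale, transpose_transpose, skew_smul, smul_mulVec,
    dotProduct_smul, ← mulVec_mulVec, triple]
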